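/- Let G be a finite group, let 𝒞 = (𝒳,𝒦) be a supercharacter theory of G, and let N be a 𝒞-normal subgroup of G. For Z ⊆ Irr(G), let f(Z) denote the set of irreducible constituents of the restricted character (σ_Z)_N. Then the collection {f(X) : X ∈ 𝒳} is a partition of Irr(N). -/

import Mathlib

open scoped Classical

noncomputable section

/-- The set of irreducible complex characters of `G`. -/
def Irr (G : Type) [Group G] : Set (G → ℂ) :=
  {χ | ∃ V : FDRep ℂ G, CategoryTheory.Simple V ∧ FDRep.character V = χ}

/-- `σ_X = ∑_{ψ ∈ X} ψ(1)·ψ`. -/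
def sigmaChar {G : Type} [Group G] (X : Set (G → ℂ)) : G → ℂ :=
  fun g => ∑ᶠ ψ ∈ X, ψ 1 * ψ g

/-- `P` is a set partition of the set `S`. -/
def IsPartitionOf {α : Type*} (S : Set α) (P : Set (Set α)) : Prop :=
  ∅ ∉ P ∧ (∀ p ∈ P, p ⊆ S) ∧ ∀ a ∈ S, ∃! p, p ∈ P ∧ a ∈ p

/-- `(𝒳, 𝒦)` is a supercharacter theory of the finite group `G`. -/
def IsSCT (G : Type) [Group G] [Finite G]
    (𝒳 : Set (Set (G → ℂ))) (𝒦 : Set (Set G)) : Prop :=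
  IsPartitionOf (Irr G) 𝒳 ∧ IsPartitionOf Set.univ 𝒦 ∧ 𝒳.ncard = 𝒦.ncard ∧
    ({1} : Set G) ∈ 𝒦 ∧
    ∀ X ∈ 𝒳, ∀ K ∈ 𝒦, ∀ g ∈ K, ∀ h ∈ K, sigmaChar X g = sigmaChar X h

/-- `K̂ = ∑_{g ∈ K} g ∈ ℂ[G]`. -/
def ghat {G : Type} [Group G] (K : Set G) : MonoidAlgebra ℂ G :=
  ∑ᶠ g ∈ K, MonoidAlgebra.single g (1 : ℂ)

/-- The central idempotent `e_χ = (χ(1)/|G|) ∑_g conj(χ g)·g` attached to a character. -/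
def eIdem (G : Type) [Group G] (χ : G → ℂ) : MonoidAlgebra ℂ G :=
  (χ 1 / (Nat.card G : ℂ)) •
    ∑ᶠ g : G, (starRingEnd ℂ) (χ g) • MonoidAlgebra.single g (1 : ℂ)

/-- `f_X = ∑_{ψ ∈ X} e_ψ`. -/
def fIdem (G : Type) [Group G] (X : Set (G → ℂ)) : MonoidAlgebra ℂ G :=
  ∑ᶠ χ ∈ X, eIdem G χ

/-- Partition order: every part of `P` lies in some part of `Q`. -/
def PartLE {α : Type*} (P Q : Set (Set α)) : Prop := ∀ p ∈ P, ∃ q ∈ Q, p ⊆ q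

/-- The join of two partitions of the same set: parts are connected components of
the relation "lying in a common part of `P` or of `Q`". -/
def PartJoin {α : Type*} (P Q : Set (Set α)) : Set (Set α) :=
  {C | ∃ a ∈ ⋃₀ P, C = {b | Relation.ReflTransGen
      (fun x y => (∃ p ∈ P, x ∈ p ∧ y ∈ p) ∨ ∃ q ∈ Q, x ∈ q ∧ y ∈ q) a b}}

/-- Inner product of complex-valued functions on a finite group. -/
def cInner (H : Type) [Group H] (α β : H → ℂ) : ℂ :=
  (Nat.card H : ℂ)⁻¹ * ∑ᶠ h : H, α h * (starRingEnd ℂ) (β h)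

/-- Restriction of a function on `G` to a subgroup. -/
def resChar {G : Type} [Group G] (H : Subgroup G) (χ : G → ℂ) : ↥H → ℂ := fun h => χ ↑h

/-- Extension by zero of a function on a subgroup. -/
def zeroExtend {G : Type} [Group G] (H : Subgroup G) (φ : ↥H → ℂ) : G → ℂ :=
  fun g => if h : g ∈ H then φ ⟨g, h⟩ else 0

/-- The induced class function `φ^G`. -/
def indChar {G : Type} [Group G] (H : Subgroup G) (φ : ↥H → ℂ) : G → ℂ :=
  fun g => (Nat.card ↥H : ℂ)⁻¹ * ∑ᶠ x : G, zeroExtend H φ (x⁻¹ * g * x)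

/-- The superclass of `x` with respect to a partition `𝒦` of `G`. -/
def sclass {G : Type} [Group G] (𝒦 : Set (Set G)) (x : G) : Set G := ⋃₀ {K ∈ 𝒦 | x ∈ K}

/-- Superinduction: `φ^{(G)}(x) = [G:H]·(1/|[x]|)·∑_{y ∈ [x]} φ⁰(y)`. -/
def superInd {G : Type} [Group G] (𝒦 : Set (Set G)) (H : Subgroup G) (φ : ↥H → ℂ) : G → ℂ :=
  fun x => (H.index : ℂ) * (((sclass 𝒦 x).ncard : ℂ))⁻¹ * ∑ᶠ y ∈ sclass 𝒦 x, zeroExtend H φ y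

/-- A subgroup is `𝒞`-normal when it is a union of superclasses. -/
def CNormal {G : Type} [Group G] (𝒦 : Set (Set G)) (N : Subgroup G) : Prop :=
  ∃ T ⊆ 𝒦, (N : Set G) = ⋃₀ T

/-- `Irr(G/N)` viewed inside `Irr(G)`: irreducible characters with `N` in their kernel. -/
def IrrOver {G : Type} [Group G] (N : Subgroup G) : Set (G → ℂ) :=
  {χ ∈ Irr G | ∀ n ∈ N, χ n = χ 1}

/-- The set of irreducible constituents of the restriction of `θ` to `N`. -/
def constituentsOn {G : Type} [Group G] (N : Subgroup G) (θ : G → ℂ) : Set (↥N → ℂ) :=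
  {ψ ∈ Irr ↥N | cInner ↥N (resChar N θ) ψ ≠ 0}

/-- `Irr(G|ψ)`: irreducible characters of `G` lying over `ψ ∈ Irr(N)`. -/
def irrOverChar {G : Type} [Group G] (N : Subgroup G) (ψ : ↥N → ℂ) : Set (G → ℂ) :=
  {χ ∈ Irr G | cInner ↥N (resChar N χ) ψ ≠ 0}

/-- `X^G = ⋃_{ψ ∈ X} Irr(G|ψ)` for `X ⊆ Irr(N)`. -/
def indSet {G : Type} [Group G] (N : Subgroup G) (X : Set (↥N → ℂ)) : Set (G → ℂ) :=
  ⋃ ψ ∈ X, irrOverChar N ψ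

/-- Conjugation of a normal subgroup by a group element. -/
def conjSub {G : Type} [Group G] {N : Subgroup G} (hN : N.Normal) (g : G) (n : ↥N) : ↥N :=
  ⟨g * ↑n * g⁻¹, hN.conj_mem ↑n n.2 g⟩

/-- The conjugation action of `g ∈ G` on class functions of a normal subgroup `N`. -/
def charConj {G : Type} [Group G] {N : Subgroup G} (hN : N.Normal) (g : G)
    (ψ : ↥N → ℂ) : ↥N → ℂ :=
  fun n => ψ (conjSub hN g⁻¹ n)

/-- Inflation of a set of characters of `G/N` to characters of `G`. -/
def inflateSet {G : Type} [Group G] (N : Subgroup G) [N.Normal]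
    (Y : Set (G ⧸ N → ℂ)) : Set (G → ℂ) :=
  (fun η => η ∘ (QuotientGroup.mk : G → G ⧸ N)) '' Y

/-- Deflation of a set of characters of `G` (with `N` in their kernels) to characters
of `G/N`. -/
def deflate {G : Type} [Group G] (N : Subgroup G) [N.Normal]
    (X : Set (G → ℂ)) : Set (G ⧸ N → ℂ) :=
  (fun χ => fun q : G ⧸ N => χ (Quotient.out q)) '' X

/-- The natural map `M → MN/N ≤ G/N`. -/
def projMN {G : Type} [Group G] (M N : Subgroup G) [N.Normal] (m : ↥M) :
    ↥(M.map (QuotientGroup.mk' N)) :=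
  ⟨QuotientGroup.mk' N ↑m, Subgroup.mem_map_of_mem _ m.2⟩

end

open CategoryTheory

section Representations

variable {H : Type} [Group H]

theorem FDRep.character_inv_eq_conj [Finite H] (V : FDRep ℂ H) (h : H) :
    V.character h⁻¹ = (starRingEnd ℂ) (V.character h) := by
  have := Fintype.ofFinite H
  open scoped ComplexOrder in
  let b := Module.finBasis ℂ V
  let M : H → Matrix _ _ ℂ := fun g => LinearMap.toMatrix b b (V.ρ g)
  have hmul (x y : H) : M (x * y) = M x * M y := by
    simp only [M, map_mul, LinearMap.toMatrix_mul]
  have hone : M 1 = 1 := by simp [M]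
  have hchar (g : H) : V.character g = (M g).trace := by
    rw [FDRep.character, LinearMap.trace_eq_matrix_trace ℂ b]
  let P := ∑ x, (M x).conjTranspose * M x
  have hPpos : P.PosDef := by
    have : P = (M 1).conjTranspose * M 1 +
        ∑ x ∈ Finset.univ.erase 1, (M x).conjTranspose * M x :=
      (Finset.add_sum_erase _ _ (Finset.mem_univ 1)).symm
    rw [this, hone, Matrix.conjTranspose_one, one_mul]
    exact Matrix.PosDef.one.add_posSemidef
      (Matrix.posSemidef_sum _ fun x _ => Matrix.posSemidef_conjTranspose_mul_self (M x))
  have hPinv : (M h).conjTranspose * P = P * M h⁻¹ := by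
    have : (M h).conjTranspose * P * M h = P := by
      simp only [P, Finset.mul_sum, Finset.sum_mul]
      refine Fintype.sum_equiv (Equiv.mulRight h) _ _ fun x => ?_
      simp [hmul, Matrix.conjTranspose_mul, mul_assoc]
    calc (M h).conjTranspose * P = (M h).conjTranspose * P * M h * M h⁻¹ := by
          rw [mul_assoc _ (M h), ← hmul, mul_inv_cancel, hone, mul_one]
      _ = P * M h⁻¹ := by rw [this]
  have hdet := (Matrix.isUnit_iff_isUnit_det P).1 hPpos.isUnit
  have : (M h).conjTranspose = P * M h⁻¹ * P⁻¹ := by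
    rw [← hPinv, mul_assoc, Matrix.mul_nonsing_inv _ hdet, mul_one]
  rw [hchar, hchar, starRingEnd_apply, ← Matrix.trace_conjTranspose, this,
    Matrix.trace_mul_comm, ← mul_assoc, Matrix.nonsing_inv_mul _ hdet, one_mul]

theorem cInner_eq_sum [Fintype H] (α β : H → ℂ) :
    cInner H α β = (Nat.card H : ℂ)⁻¹ * ∑ h, α h * (starRingEnd ℂ) (β h) := by
  rw [cInner, finsum_eq_sum_of_fintype]

/-- The inner product with a fixed second argument, as a linear functional. -/
noncomputable def cInnerLeft [Finite H] (β : H → ℂ) : (H → ℂ) →ₗ[ℂ] ℂ where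
  toFun α := cInner H α β
  map_add' α α' := by
    have := Fintype.ofFinite H
    simp [cInner_eq_sum, add_mul, Finset.sum_add_distrib, mul_add]
  map_smul' c α := by
    have := Fintype.ofFinite H
    simp only [cInner_eq_sum, Pi.smul_apply, smul_eq_mul, RingHom.id_apply, mul_assoc,
      ← Finset.mul_sum]
    ring

@[simp]
theorem cInnerLeft_apply [Finite H] (α β : H → ℂ) : cInnerLeft β α = cInner H α β := rfl

theorem cInner_character_eq_finrank [Finite H] (V W : FDRep ℂ H) :
    cInner H W.character V.character = Module.finrank ℂ (V ⟶ W) := by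
  have := Fintype.ofFinite H
  have := invertibleOfNonzero (NeZero.ne (Nat.card H : ℂ))
  rw [← FDRep.scalar_product_char_eq_finrank_equivariant, cInner_eq_sum]
  simp only [FDRep.character_inv_eq_conj]

theorem cInner_of_mem_Irr [Finite H] {χ ψ : H → ℂ} (hχ : χ ∈ Irr H) (hψ : ψ ∈ Irr H) :
    cInner H χ ψ = if χ = ψ then 1 else 0 := by
  obtain ⟨V, hV, rfl⟩ := hχ
  obtain ⟨W, hW, rfl⟩ := hψ
  rw [cInner_character_eq_finrank]
  split_ifs with h
  · rw [← cInner_character_eq_finrank, ← h, cInner_character_eq_finrank,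
      finrank_endomorphism_simple_eq_one, Nat.cast_one]
  · rw [FDRep.finrank_hom_simple_simple, if_neg, Nat.cast_zero]
    rintro ⟨i⟩
    exact h (FDRep.char_iso i).symm

theorem FDRep.exists_hom_of_comm {V W : FDRep ℂ H} (T : V →ₗ[ℂ] W)
    (hT : ∀ g, T ∘ₗ V.ρ g = W.ρ g ∘ₗ T) : ∃ F : V ⟶ W, F.hom.hom.hom = T :=
  ⟨⟨InducedCategory.homMk (ModuleCat.ofHom T), fun g => by ext1; exact hT g⟩, rfl⟩

theorem FDRep.hom_comm {V W : FDRep ℂ H} (F : V ⟶ W) (g : H) :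
    F.hom.hom.hom ∘ₗ V.ρ g = W.ρ g ∘ₗ F.hom.hom.hom :=
  congrArg (fun f => f.hom.hom) (F.comm g)

theorem FDRep.hom_hom_hom_ne_zero {V W : FDRep ℂ H} {F : V ⟶ W} (hF : F ≠ 0) :
    F.hom.hom.hom ≠ 0 := fun h => hF (by ext : 3; rw [h]; rfl)

theorem FDRep.character_one_ne_zero_of_simple (V : FDRep ℂ H) [Simple V] :
    V.character 1 ≠ 0 := by
  rw [FDRep.char_one, Nat.cast_ne_zero]
  intro h
  have := Module.finrank_zero_iff.1 h
  exact FDRep.hom_hom_hom_ne_zero (id_nonzero V) (Subsingleton.elim _ _)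

theorem Irr.apply_one_ne_zero {χ : H → ℂ} (hχ : χ ∈ Irr H) : χ 1 ≠ 0 := by
  obtain ⟨V, hV, rfl⟩ := hχ
  exact V.character_one_ne_zero_of_simple

theorem Irr.conj_apply {χ : H → ℂ} (hχ : χ ∈ Irr H) (g h : H) : χ (h * g * h⁻¹) = χ g := by
  obtain ⟨V, hV, rfl⟩ := hχ
  exact V.char_conj g h

/-- By Schur's lemma, `∑ h, a h • ρ h⁻¹` is a scalar on a simple representation when `a` is a
class function. -/
theorem FDRep.sum_smul_ρ_inv_eq_smul_id [Fintype H] (V : FDRep ℂ H) [Simple V] {a : H → ℂ}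
    (ha : ∀ g h, a (h * g * h⁻¹) = a g) :
    ∃ c : ℂ, ∑ h, a h • V.ρ h⁻¹ = c • LinearMap.id ∧
      cInner H a V.character * Nat.card H = c * V.character 1 := by
  obtain ⟨F, hF⟩ := FDRep.exists_hom_of_comm (V := V) (W := V) (∑ h, a h • V.ρ h⁻¹) fun g => by
    change (∑ h, a h • V.ρ h⁻¹) * V.ρ g = V.ρ g * ∑ h, a h • V.ρ h⁻¹
    simp only [Finset.mul_sum, Finset.sum_mul, smul_mul_assoc, mul_smul_comm, ← map_mul]
    refine Fintype.sum_equiv (MulAut.conj g⁻¹).toEquiv _ _ fun x => ?_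
    rw [MulEquiv.toEquiv_eq_coe, MulEquiv.coe_toEquiv, MulAut.conj_apply, ha]
    congr 2
    group
  obtain ⟨c, rfl⟩ := endomorphism_simple_eq_smul_id ℂ F
  have hc : ∑ h, a h • V.ρ h⁻¹ = c • LinearMap.id := hF.symm
  refine ⟨c, hc, ?_⟩
  have htrace := congrArg (LinearMap.trace ℂ V) hc
  simp only [map_sum, map_smul, LinearMap.trace_id, smul_eq_mul] at htrace
  rw [FDRep.char_one, ← htrace, cInner_eq_sum, mul_right_comm,
    inv_mul_cancel₀ (NeZero.ne (Nat.card H : ℂ)), one_mul]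
  exact Finset.sum_congr rfl fun h _ => by
    rw [← FDRep.character_inv_eq_conj]; rfl

theorem FDRep.exists_simple_hom_ne_zero (V : FDRep ℂ H) (hV : V.character 1 ≠ 0) :
    ∃ (W : FDRep ℂ H) (f : W ⟶ V), Simple W ∧ f ≠ 0 := by
  have hex : ∃ n : ℕ, ∃ (W : FDRep ℂ H) (f : W ⟶ V), Mono f ∧ f ≠ 0 ∧
      Module.finrank ℂ W = n := by
    refine ⟨_, V, 𝟙 V, inferInstance, fun h => hV ?_, rfl⟩
    have hid : (LinearMap.id : V →ₗ[ℂ] V) = 0 := congrArg (fun f => f.hom.hom.hom) h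
    rw [FDRep.char_one, ← LinearMap.trace_id, hid, map_zero]
  obtain ⟨W, f, hmono, hf, hW⟩ := Nat.find_spec hex
  refine ⟨W, f, ⟨fun {Y} i _ => ⟨fun hi h0 => ?_, fun hi => ?_⟩⟩, hf⟩
  · refine hf ((cancel_epi i).1 ?_)
    rw [h0, Limits.zero_comp, Limits.zero_comp]
  · have hle : Module.finrank ℂ W ≤ Module.finrank ℂ Y := by
      rw [hW]
      refine Nat.find_min' hex ⟨Y, i ≫ f, mono_comp i f, fun h => hi ?_, rfl⟩
      rw [← cancel_mono f, h, Limits.zero_comp]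
    have hinj : Function.Injective i.hom.hom.hom :=
      (ModuleCat.mono_iff_injective _).1 (inferInstanceAs (Mono
        ((Action.forget (FGModuleCat ℂ) H ⋙ forget₂ (FGModuleCat ℂ) (ModuleCat ℂ)).map i)))
    let e := LinearEquiv.ofInjectiveOfFinrankEq i.hom.hom.hom hinj
      (le_antisymm (LinearMap.finrank_le_finrank_of_injective hinj) hle)
    have : IsIso i.hom := e.toFGModuleCatIso.isIso_hom
    infer_instance

end Representations

section Restriction

variable {G : Type} [Group G]

theorem sigmaChar_eq_sum {X : Set (G → ℂ)} (hX : X.Finite) :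
    sigmaChar X = ∑ χ ∈ hX.toFinset, χ 1 • χ := by
  ext g
  rw [sigmaChar, finsum_mem_eq_finite_toFinset_sum _ hX, Finset.sum_apply]
  rfl

/-- Restriction of functions to a subgroup, as a linear map. -/
def resCharLinear (N : Subgroup G) : (G → ℂ) →ₗ[ℂ] (↥N → ℂ) :=
  LinearMap.funLeft ℂ ℂ (Subtype.val : ↥N → G)

@[simp]
theorem resCharLinear_apply (N : Subgroup G) (χ : G → ℂ) :
    resCharLinear N χ = resChar N χ := rfl

variable [Finite G]

/-- If `ψ ∈ Irr N` lies under `χ ∈ Irr G`, a class function of `G` vanishing off `N` acts by the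
same scalar on representations affording `χ` and `ψ`. -/
theorem cInner_resChar_mul_eq (N : Subgroup G) {a : G → ℂ}
    (ha : ∀ g h, a (h * g * h⁻¹) = a g) (haN : ∀ g ∉ N, a g = 0)
    {χ : G → ℂ} (hχ : χ ∈ Irr G) {ψ : ↥N → ℂ} (hψ : ψ ∈ Irr ↥N)
    (hχψ : cInner ↥N (resChar N χ) ψ ≠ 0) :
    cInner ↥N (resChar N a) ψ * Nat.card ↥N * χ 1 = cInner G a χ * Nat.card G * ψ 1 := by
  have := Fintype.ofFinite G
  obtain ⟨V, hV, rfl⟩ := hχ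
  obtain ⟨W, hW, rfl⟩ := hψ
  let V' : FDRep ℂ ↥N := FDRep.of (V.ρ.comp N.subtype)
  rw [show resChar N V.character = V'.character from rfl, cInner_character_eq_finrank,
    Nat.cast_ne_zero] at hχψ
  obtain ⟨F, hF⟩ := Module.finrank_pos_iff_exists_ne_zero.1 (Nat.pos_of_ne_zero hχψ)
  obtain ⟨c, hc, hcV⟩ := V.sum_smul_ρ_inv_eq_smul_id ha
  obtain ⟨d, hd, hdW⟩ := W.sum_smul_ρ_inv_eq_smul_id (a := resChar N a)
    fun g h => ha g h
  have hres : ∑ n : ↥N, resChar N a n • V'.ρ n⁻¹ = ∑ g, a g • V.ρ g⁻¹ := by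
    symm
    rw [← Finset.sum_subset (Finset.subset_univ (Finset.univ.filter (· ∈ N)))
      fun g _ hg => by rw [haN g (by simpa using hg), zero_smul]]
    exact Finset.sum_subtype _ (by simp) _
  have hcomm : F.hom.hom.hom ∘ₗ (∑ n : ↥N, resChar N a n • W.ρ n⁻¹) =
      (∑ n : ↥N, resChar N a n • V'.ρ n⁻¹) ∘ₗ F.hom.hom.hom := by
    ext w
    simp only [LinearMap.comp_apply, LinearMap.sum_apply, LinearMap.smul_apply, map_sum, map_smul]
    exact Finset.sum_congr rfl fun n _ =>
      congrArg (resChar N a n • ·) (LinearMap.congr_fun (FDRep.hom_comm F n⁻¹) w)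
  rw [hres, hc, hd] at hcomm
  have hdc : (d - c) • F.hom.hom.hom = 0 := by
    rw [LinearMap.comp_smul, LinearMap.smul_comp] at hcomm
    rw [sub_smul, sub_eq_zero]
    exact hcomm
  have hdc : d = c :=
    sub_eq_zero.1 ((smul_eq_zero.1 hdc).resolve_right (FDRep.hom_hom_hom_ne_zero hF))
  rw [hcV, hdW, hdc]
  ring

theorem exists_mem_Irr_cInner_resChar_ne_zero (N : Subgroup G) {χ : G → ℂ} (hχ : χ ∈ Irr G) :
    ∃ ψ ∈ Irr ↥N, cInner ↥N (resChar N χ) ψ ≠ 0 := by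
  have h1 := Irr.apply_one_ne_zero hχ
  obtain ⟨V, hV, rfl⟩ := hχ
  let V' : FDRep ℂ ↥N := FDRep.of (V.ρ.comp N.subtype)
  have hres : resChar N V.character = V'.character := rfl
  obtain ⟨W, f, hW, hf⟩ := V'.exists_simple_hom_ne_zero (by rwa [← hres])
  refine ⟨_, ⟨W, hW, rfl⟩, ?_⟩
  rw [hres, cInner_character_eq_finrank, Nat.cast_ne_zero]
  exact (Module.finrank_pos_iff_exists_ne_zero.2 ⟨f, hf⟩).ne'

theorem exists_nat_mul_cInner_resChar (N : Subgroup G) {χ : G → ℂ} (hχ : χ ∈ Irr G)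
    {ψ : ↥N → ℂ} (hψ : ψ ∈ Irr ↥N) :
    ∃ n : ℕ, χ 1 * cInner ↥N (resChar N χ) ψ = n := by
  obtain ⟨V, hV, rfl⟩ := hχ
  obtain ⟨W, hW, rfl⟩ := hψ
  let V' : FDRep ℂ ↥N := FDRep.of (V.ρ.comp N.subtype)
  rw [show resChar N V.character = V'.character from rfl, cInner_character_eq_finrank,
    FDRep.char_one]
  exact ⟨_, (Nat.cast_mul _ _).symm⟩

theorem Irr.finite : (Irr G).Finite := by
  have hli : LinearIndependent ℂ (Subtype.val : Irr G → G → ℂ) := by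
    rw [linearIndependent_iff']
    intro s c hsum χ hχs
    have h := congrArg (cInnerLeft χ.1) hsum
    rw [map_zero] at h
    simpa [cInner_of_mem_Irr (Subtype.prop _) χ.2, Subtype.val_inj, hχs] using h
  exact hli.finite

theorem cInner_sigmaChar {X : Set (G → ℂ)} (hX : X ⊆ Irr G) {χ : G → ℂ} (hχ : χ ∈ Irr G) :
    cInner G (sigmaChar X) χ = if χ ∈ X then χ 1 else 0 := by
  have hfin := Irr.finite.subset hX
  rw [sigmaChar_eq_sum hfin, ← cInnerLeft_apply, map_sum]
  trans ∑ ψ ∈ hfin.toFinset, if ψ = χ then χ 1 else 0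
  · refine Finset.sum_congr rfl fun ψ hψ => ?_
    rw [map_smul, cInnerLeft_apply, cInner_of_mem_Irr (hX (hfin.mem_toFinset.1 hψ)) hχ]
    split_ifs with h <;> simp [h]
  · simp

theorem sigmaChar_conj_apply {X : Set (G → ℂ)} (hX : X ⊆ Irr G) (g h : G) :
    sigmaChar X (h * g * h⁻¹) = sigmaChar X g := by
  have hfin := Irr.finite.subset hX
  simp only [sigmaChar_eq_sum hfin, Finset.sum_apply, Pi.smul_apply]
  exact Finset.sum_congr rfl fun ψ hψ => by
    rw [Irr.conj_apply (hX (hfin.mem_toFinset.1 hψ))]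

theorem cInner_resChar_sigmaChar (N : Subgroup G) {X : Set (G → ℂ)} (hX : X.Finite)
    (ψ : ↥N → ℂ) :
    cInner ↥N (resChar N (sigmaChar X)) ψ =
      ∑ χ ∈ hX.toFinset, χ 1 * cInner ↥N (resChar N χ) ψ := by
  rw [sigmaChar_eq_sum hX, ← cInnerLeft_apply, ← resCharLinear_apply, map_sum, map_sum]
  simp

theorem constituentsOn_sigmaChar_nonempty (N : Subgroup G) {X : Set (G → ℂ)} (hX : X ⊆ Irr G)
    (hne : X.Nonempty) : (constituentsOn N (sigmaChar X)).Nonempty := by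
  obtain ⟨χ, hχ⟩ := hne
  have hfin := Irr.finite.subset hX
  obtain ⟨ψ, hψ, hχψ⟩ := exists_mem_Irr_cInner_resChar_ne_zero N (hX hχ)
  refine ⟨ψ, hψ, ?_⟩
  choose! n hn using fun (χ : G → ℂ) (h : χ ∈ X) => exists_nat_mul_cInner_resChar N (hX h) hψ
  rw [cInner_resChar_sigmaChar N hfin,
    Finset.sum_congr rfl fun χ h => hn χ (hfin.mem_toFinset.1 h), ← Nat.cast_sum,
    Nat.cast_ne_zero]
  intro hsum
  have h0 := Finset.sum_eq_zero_iff.1 hsum χ (hfin.mem_toFinset.2 hχ)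
  have := hn χ hχ
  rw [h0, Nat.cast_zero] at this
  exact mul_ne_zero (Irr.apply_one_ne_zero (hX hχ)) hχψ this

theorem exists_mem_of_mem_constituentsOn_sigmaChar (N : Subgroup G) {X : Set (G → ℂ)}
    (hX : X ⊆ Irr G) {ψ : ↥N → ℂ} (hψ : ψ ∈ constituentsOn N (sigmaChar X)) :
    ∃ χ ∈ X, cInner ↥N (resChar N χ) ψ ≠ 0 := by
  have hfin := Irr.finite.subset hX
  have h := hψ.2
  rw [cInner_resChar_sigmaChar N hfin] at h
  obtain ⟨χ, hχ, hne⟩ := Finset.exists_ne_zero_of_sum_ne_zero h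
  exact ⟨χ, hfin.mem_toFinset.1 hχ, right_ne_zero_of_mul hne⟩

end Restriction

section Supercharacters

variable {G : Type}

/-- The functions on `G` that are constant on every member of `𝒦`. -/
def superclassFunctions (𝒦 : Set (Set G)) : Submodule ℂ (G → ℂ) where
  carrier := {a | ∀ K ∈ 𝒦, ∀ g ∈ K, ∀ h ∈ K, a g = a h}
  add_mem' ha hb K hK g hg h hh := by
    rw [Pi.add_apply, Pi.add_apply, ha K hK g hg h hh, hb K hK g hg h hh]
  zero_mem' _ _ _ _ _ _ := rfl
  smul_mem' c a ha K hK g hg h hh := by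
    rw [Pi.smul_apply, Pi.smul_apply, ha K hK g hg h hh]

theorem IsPartitionOf.eq_of_mem {α : Type*} {S : Set α} {P : Set (Set α)}
    (hP : IsPartitionOf S P) {p q : Set α} (hp : p ∈ P) (hq : q ∈ P) {x : α}
    (hxp : x ∈ p) (hxq : x ∈ q) : p = q :=
  (hP.2.2 x (hP.2.1 p hp hxp)).unique ⟨hp, hxp⟩ ⟨hq, hxq⟩

theorem finrank_superclassFunctions_le [Finite G] {𝒦 : Set (Set G)} (h𝒦 : IsPartitionOf Set.univ 𝒦) :
    Module.finrank ℂ (superclassFunctions 𝒦) ≤ 𝒦.ncard := by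
  have : Fintype 𝒦 := Fintype.ofFinite 𝒦
  have hne (K : 𝒦) : K.1.Nonempty :=
    Set.nonempty_iff_ne_empty.2 fun h => h𝒦.1 (h ▸ K.2)
  choose r hr using hne
  let L : superclassFunctions 𝒦 →ₗ[ℂ] (𝒦 → ℂ) :=
    LinearMap.funLeft ℂ ℂ r ∘ₗ (superclassFunctions 𝒦).subtype
  have hL : Function.Injective L := by
    rintro ⟨a, ha⟩ ⟨b, hb⟩ hab
    ext g
    obtain ⟨K, ⟨hK, hgK⟩, -⟩ := h𝒦.2.2 g (Set.mem_univ g)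
    have h : a (r ⟨K, hK⟩) = b (r ⟨K, hK⟩) := congrFun hab ⟨K, hK⟩
    exact (ha K hK g hgK _ (hr ⟨K, hK⟩)).trans (h.trans (hb K hK _ (hr ⟨K, hK⟩) g hgK))
  calc Module.finrank ℂ (superclassFunctions 𝒦) ≤ Module.finrank ℂ (𝒦 → ℂ) :=
        LinearMap.finrank_le_finrank_of_injective hL
    _ = 𝒦.ncard := by
        rw [Module.finrank_fintype_fun_eq_card, ← Nat.card_coe_set_eq, Nat.card_eq_fintype_card]

theorem zeroExtend_mem_superclassFunctions [Group G] {𝒦 : Set (Set G)}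
    (h𝒦 : IsPartitionOf Set.univ 𝒦) {N : Subgroup G} (hN : CNormal 𝒦 N)
    {a : G → ℂ} (ha : a ∈ superclassFunctions 𝒦) :
    zeroExtend N (resChar N a) ∈ superclassFunctions 𝒦 := by
  obtain ⟨T, hT, hNT⟩ := hN
  have hmem {K : Set G} (hK : K ∈ 𝒦) {g h : G} (hg : g ∈ K) (hh : h ∈ K) (hgN : g ∈ N) :
      h ∈ N := by
    rw [← SetLike.mem_coe, hNT] at hgN ⊢
    obtain ⟨K', hK', hgK'⟩ := hgN
    exact ⟨K', hK', h𝒦.eq_of_mem hK (hT hK') hg hgK' ▸ hh⟩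
  intro K hK g hg h hh
  by_cases hgN : g ∈ N
  · simpa [zeroExtend, resChar, hgN, hmem hK hg hh hgN] using ha K hK g hg h hh
  · have hhN : h ∉ N := fun hhN => hgN (hmem hK hh hg hhN)
    simp [zeroExtend, hgN, hhN]

variable [Group G] [Finite G] {𝒳 : Set (Set (G → ℂ))} {𝒦 : Set (Set G)}

theorem cInner_sum_smul_sigmaChar (h𝒳 : IsPartitionOf (Irr G) 𝒳) (s : Finset 𝒳) (c : 𝒳 → ℂ)
    {X : 𝒳} (hX : X ∈ s) {χ : G → ℂ} (hχ : χ ∈ X.1) :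
    cInner G (∑ Y ∈ s, c Y • sigmaChar Y.1) χ = c X * χ 1 := by
  rw [← cInnerLeft_apply, map_sum, Finset.sum_eq_single_of_mem X hX]
  · rw [map_smul, cInnerLeft_apply,
      cInner_sigmaChar (h𝒳.2.1 _ X.2) (h𝒳.2.1 _ X.2 hχ), if_pos hχ, smul_eq_mul]
  · intro Y _ hYX
    rw [map_smul, cInnerLeft_apply, cInner_sigmaChar (h𝒳.2.1 _ Y.2) (h𝒳.2.1 _ X.2 hχ),
      if_neg fun h => hYX (Subtype.ext (h𝒳.eq_of_mem Y.2 X.2 h hχ)), smul_zero]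

theorem IsSCT.span_sigmaChar_eq (hSCT : IsSCT G 𝒳 𝒦) :
    Submodule.span ℂ (Set.range fun X : 𝒳 => sigmaChar X.1) = superclassFunctions 𝒦 := by
  obtain ⟨h𝒳, h𝒦, hcard, -, hconst⟩ := hSCT
  have hfin : 𝒳.Finite := Irr.finite.finite_subsets.subset h𝒳.2.1
  have : Fintype 𝒳 := hfin.fintype
  have hli : LinearIndependent ℂ fun X : 𝒳 => sigmaChar X.1 := by
    rw [linearIndependent_iff']
    intro s c hsum X hX
    obtain ⟨χ, hχ⟩ := Set.nonempty_iff_ne_empty.2 fun h : X.1 = ∅ => h𝒳.1 (h ▸ X.2)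
    have h := cInner_sum_smul_sigmaChar h𝒳 s c hX hχ
    rw [hsum, ← cInnerLeft_apply, map_zero] at h
    exact (mul_eq_zero.1 h.symm).resolve_right (Irr.apply_one_ne_zero (h𝒳.2.1 _ X.2 hχ))
  refine Submodule.eq_of_le_of_finrank_le (Submodule.span_le.2 ?_) ?_
  · rintro _ ⟨X, rfl⟩
    exact hconst X.1 X.2
  · rw [finrank_span_eq_card hli, ← Nat.card_eq_fintype_card, Nat.card_coe_set_eq, hcard]
    exact finrank_superclassFunctions_le h𝒦

theorem IsSCT.exists_eq_sum_smul_sigmaChar (hSCT : IsSCT G 𝒳 𝒦) {a : G → ℂ}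
    (ha : a ∈ superclassFunctions 𝒦) :
    ∃ (_ : Fintype 𝒳) (c : 𝒳 → ℂ), a = ∑ X, c X • sigmaChar X.1 := by
  have hfin : 𝒳.Finite := Irr.finite.finite_subsets.subset hSCT.1.2.1
  have : Fintype 𝒳 := hfin.fintype
  rw [← hSCT.span_sigmaChar_eq, Submodule.mem_span_range_iff_exists_fun] at ha
  obtain ⟨c, hc⟩ := ha
  exact ⟨this, c, hc.symm⟩

theorem IsSCT.conj_apply_of_mem (hSCT : IsSCT G 𝒳 𝒦) {a : G → ℂ}
    (ha : a ∈ superclassFunctions 𝒦) (g h : G) : a (h * g * h⁻¹) = a g := by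
  obtain ⟨_, c, rfl⟩ := hSCT.exists_eq_sum_smul_sigmaChar ha
  simp only [Finset.sum_apply, Pi.smul_apply, sigmaChar_conj_apply (hSCT.1.2.1 _ (Subtype.prop _))]

theorem IsSCT.constituentsOn_subset (hSCT : IsSCT G 𝒳 𝒦) {N : Subgroup G} (hN : CNormal 𝒦 N)
    {X Y : Set (G → ℂ)} (hX : X ∈ 𝒳) (hY : Y ∈ 𝒳) {ψ : ↥N → ℂ}
    (hψX : ψ ∈ constituentsOn N (sigmaChar X)) (hψY : ψ ∈ constituentsOn N (sigmaChar Y)) :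
    constituentsOn N (sigmaChar Y) ⊆ constituentsOn N (sigmaChar X) := by
  have hYIrr := hSCT.1.2.1 Y hY
  set a := zeroExtend N (resChar N (sigmaChar X)) with ha_def
  have ha : a ∈ superclassFunctions 𝒦 :=
    zeroExtend_mem_superclassFunctions hSCT.2.1 hN (hSCT.2.2.2.2 X hX)
  have haN (g : G) (hg : g ∉ N) : a g = 0 := by simp [ha_def, zeroExtend, hg]
  have hres : resChar N a = resChar N (sigmaChar X) := by
    ext n
    simp [ha_def, zeroExtend, resChar]
  obtain ⟨_, c, hc⟩ := hSCT.exists_eq_sum_smul_sigmaChar ha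
  have key {φ : ↥N → ℂ} (hφ : φ ∈ constituentsOn N (sigmaChar Y)) :
      cInner ↥N (resChar N (sigmaChar X)) φ * Nat.card ↥N =
        c ⟨Y, hY⟩ * Nat.card G * φ 1 := by
    obtain ⟨χ, hχ, hχφ⟩ := exists_mem_of_mem_constituentsOn_sigmaChar N hYIrr hφ
    have h := cInner_resChar_mul_eq N (hSCT.conj_apply_of_mem ha) haN (hYIrr hχ) hφ.1 hχφ
    have hinner := cInner_sum_smul_sigmaChar hSCT.1 Finset.univ c
      (Finset.mem_univ ⟨Y, hY⟩) hχ
    rw [← hc] at hinner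
    rw [hres, hinner] at h
    exact mul_right_cancel₀ (Irr.apply_one_ne_zero (hYIrr hχ)) (h.trans (by ring))
  have hcY : c ⟨Y, hY⟩ ≠ 0 := fun h0 => by
    have h := key hψY
    rw [h0, zero_mul, zero_mul] at h
    exact mul_ne_zero hψX.2 (NeZero.ne _) h
  refine fun φ hφ => ⟨hφ.1, fun h0 => ?_⟩
  have h := key hφ
  rw [h0, zero_mul] at h
  exact mul_ne_zero (mul_ne_zero hcY (NeZero.ne _)) (Irr.apply_one_ne_zero hφ.1) h.symm

theorem IsSCT.exists_mem_constituentsOn (hSCT : IsSCT G 𝒳 𝒦) (N : Subgroup G) {ψ : ↥N → ℂ}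
    (hψ : ψ ∈ Irr ↥N) : ∃ X ∈ 𝒳, ψ ∈ constituentsOn N (sigmaChar X) := by
  have := Fintype.ofFinite G
  have hδ : (Pi.single 1 1 : G → ℂ) ∈ superclassFunctions 𝒦 := by
    intro K hK g hg h hh
    by_cases h1 : (1 : G) ∈ K
    · obtain rfl := hSCT.2.1.eq_of_mem hK hSCT.2.2.2.1 h1 rfl
      rw [Set.mem_singleton_iff.1 hg, Set.mem_singleton_iff.1 hh]
    · rw [Pi.single_eq_of_ne (ne_of_mem_of_not_mem hg h1),
        Pi.single_eq_of_ne (ne_of_mem_of_not_mem hh h1)]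
  obtain ⟨_, c, hc⟩ := hSCT.exists_eq_sum_smul_sigmaChar hδ
  have hne : cInner ↥N (resChar N (Pi.single 1 1)) ψ ≠ 0 := by
    have : resChar N (Pi.single 1 1) = Pi.single 1 1 := by
      ext n
      simp [resChar, Pi.single_apply]
    rw [cInner_eq_sum, this]
    simp [Pi.single_apply, Irr.apply_one_ne_zero hψ]
  rw [hc, ← cInnerLeft_apply, ← resCharLinear_apply, map_sum, map_sum] at hne
  obtain ⟨X, -, hX⟩ := Finset.exists_ne_zero_of_sum_ne_zero hne
  rw [map_smul, map_smul] at hX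
  exact ⟨X.1, X.2, hψ, right_ne_zero_of_mul hX⟩

end Supercharacters

/-- If `N` is `𝒞`-normal, then `{f(X) : X ∈ 𝒳}` is a partition of
`Irr(N)`, where `f(X)` is the set of irreducible constituents of `(σ_X)_N`. -/
theorem stmt14 (G : Type) [Group G] [Finite G]
    (𝒳 : Set (Set (G → ℂ))) (𝒦 : Set (Set G)) (hSCT : IsSCT G 𝒳 𝒦)
    (N : Subgroup G) (hN : CNormal 𝒦 N) :
    IsPartitionOf (Irr ↥N) ((fun X => constituentsOn N (sigmaChar X)) '' 𝒳) := by
  obtain ⟨hne, hsub, -⟩ := hSCT.1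
  refine ⟨?_, ?_, fun ψ hψ => ?_⟩
  · rintro ⟨X, hX, hempty⟩
    exact (constituentsOn_sigmaChar_nonempty N (hsub X hX)
      (Set.nonempty_iff_ne_empty.2 fun h => hne (h ▸ hX))).ne_empty hempty
  · rintro _ ⟨X, -, rfl⟩
    exact fun ψ hψ => hψ.1
  · obtain ⟨X, hX, hψX⟩ := hSCT.exists_mem_constituentsOn N hψ
    refine ⟨_, ⟨⟨X, hX, rfl⟩, hψX⟩, ?_⟩
    rintro _ ⟨⟨Y, hY, rfl⟩, hψY⟩
    exact Set.Subset.antisymm (hSCT.constituentsOn_subset hN hX hY hψX hψY)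
      (hSCT.constituentsOn_subset hN hY hX hψY hψX)
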